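/- An irreflexive tournament without two arc-disjoint directed triangles is obtained from an irreflexive transitive tournament by reversing at most one arc, and conversely. -/

import Mathlib

def DirTriangle {V : Type*} (A : V → V → Prop) (u v w : V) : Prop :=
  u ≠ v ∧ v ≠ w ∧ w ≠ u ∧ A u v ∧ A v w ∧ A w u

def ReverseAtMostOneArc {V : Type*} (A : V → V → Prop) : Prop :=
  ∃ r : V → V → Prop, IsStrictTotalOrder V r ∧
    ((∀ u v : V, r u v → A u v) ∨
      ∃ a b : V, r a b ∧ A b a ∧
        ∀ u v : V, r u v → ¬ (u = a ∧ v = b) → A u v)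

/-- The cyclic triple `x, y, z` passes through the arc `(a, b)`. -/
def TriangleHasArc {V : Type*} (a b x y z : V) : Prop :=
  (x = a ∧ y = b) ∨ (y = a ∧ z = b) ∨ (z = a ∧ x = b)

lemma DirTriangle.rotate {V : Type*} {A : V → V → Prop} {u v w : V} (h : DirTriangle A u v w) :
    DirTriangle A v w u := by
  obtain ⟨h1, h2, h3, h4, h5, h6⟩ := h
  exact ⟨h2, h3, h1, h5, h6, h4⟩

lemma exists_triangleHasArc_of_inter_nonempty {V : Type*} {u v w x y z : V}
    (h : ({(u, v), (v, w), (w, u)} : Set (V × V)) ∩ {(x, y), (y, z), (z, x)} ≠ ∅) :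
    TriangleHasArc u v x y z ∨ TriangleHasArc v w x y z ∨ TriangleHasArc w u x y z := by
  obtain ⟨⟨p, q⟩, h1, h2⟩ := Set.nonempty_iff_ne_empty.mpr h
  simp only [Set.mem_insert_iff, Set.mem_singleton_iff, Prod.mk.injEq] at h1 h2
  unfold TriangleHasArc
  grind

section Tournament

variable {V : Type*} {A : V → V → Prop}

/-- If directed triangles pairwise share an arc and two of them lie on `(a, b)`, all of them do. -/
lemma triangleHasArc_of_two_triangles (hasymm : ∀ u v, A u v → ¬ A v u)
    (hshare : ∀ u v w x y z, DirTriangle A u v w → DirTriangle A x y z →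
      TriangleHasArc u v x y z ∨ TriangleHasArc v w x y z ∨ TriangleHasArc w u x y z)
    {a b c d : V} (hc : DirTriangle A a b c) (hd : DirTriangle A a b d) (hcd : c ≠ d)
    {x y z : V} (h : DirTriangle A x y z) : TriangleHasArc a b x y z := by
  have h1 := hshare _ _ _ _ _ _ hc h
  have h2 := hshare _ _ _ _ _ _ hd h
  unfold DirTriangle at hc hd h
  unfold TriangleHasArc at *
  grind

/-- Directed triangles that pairwise share an arc all share a common arc of any one of them. -/
lemma exists_common_arc (hasymm : ∀ u v, A u v → ¬ A v u)
    (hshare : ∀ u v w x y z, DirTriangle A u v w → DirTriangle A x y z →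
      TriangleHasArc u v x y z ∨ TriangleHasArc v w x y z ∨ TriangleHasArc w u x y z)
    {a b c : V} (h : DirTriangle A a b c) :
    ∃ p q s, DirTriangle A p q s ∧
      ∀ x y z, DirTriangle A x y z → TriangleHasArc p q x y z := by
  by_cases h1 : ∃ d, DirTriangle A a b d ∧ c ≠ d
  · obtain ⟨d, hd, hne⟩ := h1
    exact ⟨a, b, c, h, fun _ _ _ => triangleHasArc_of_two_triangles hasymm hshare h hd hne⟩
  by_cases h2 : ∃ d, DirTriangle A b c d ∧ a ≠ d
  · obtain ⟨d, hd, hne⟩ := h2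
    exact ⟨b, c, a, h.rotate,
      fun _ _ _ => triangleHasArc_of_two_triangles hasymm hshare h.rotate hd hne⟩
  by_cases h3 : ∃ d, DirTriangle A c a d ∧ b ≠ d
  · obtain ⟨d, hd, hne⟩ := h3
    exact ⟨c, a, b, h.rotate.rotate,
      fun _ _ _ => triangleHasArc_of_two_triangles hasymm hshare h.rotate.rotate hd hne⟩
  push Not at h1 h2 h3
  refine ⟨a, b, c, h, fun x y z hx => ?_⟩
  have h4 := hshare _ _ _ _ _ _ h hx
  have h5 := hx.rotate
  have h6 := h5.rotate
  unfold TriangleHasArc at *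
  grind

/-- A tournament relation without directed triangles is a strict total order. -/
lemma isStrictTotalOrder_of_no_dirTriangle (htotal : ∀ u v, u ≠ v → A u v ∨ A v u)
    (hasymm : ∀ u v, A u v → ¬ A v u) (h : ∀ u v w, ¬ DirTriangle A u v w) :
    IsStrictTotalOrder V A where
  trichotomous u v h1 h2 := by
    by_contra hne
    exact (htotal u v hne).elim h1 h2
  irrefl u hu := hasymm u u hu hu
  trans u v w huv hvw := by
    by_contra huw
    have := h u v w
    unfold DirTriangle at this
    grind

/-- Reversing an arc common to all directed triangles of a tournament destroys them all. -/
lemma reverse_common_arc_isStrictTotalOrder (htotal : ∀ u v, u ≠ v → A u v ∨ A v u)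
    (hasymm : ∀ u v, A u v → ¬ A v u) {a b c : V} (habc : DirTriangle A a b c)
    (hcommon : ∀ x y z, DirTriangle A x y z → TriangleHasArc a b x y z) :
    IsStrictTotalOrder V
      (fun u v => (u = b ∧ v = a) ∨ (A u v ∧ ¬ (u = a ∧ v = b))) := by
  have hno_between : ∀ y, A a y → ¬ A y b := by
    intro y hay hyb
    have h1 := hcommon c y b
    have h2 := hcommon a y c
    have h3 := htotal c y
    have hay' : a ≠ y := fun h => hasymm a y hay (by rwa [h] at hay ⊢)
    have hyb' : y ≠ b := fun h => hasymm y b hyb (by rwa [h] at hyb ⊢)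
    clear hcommon htotal
    unfold DirTriangle TriangleHasArc at *
    grind
  have hab : a ≠ b ∧ A a b := ⟨habc.1, habc.2.2.2.1⟩
  refine isStrictTotalOrder_of_no_dirTriangle (fun u v huv => ?_) (fun u v huv => ?_)
    (fun x y z h => ?_)
  · have := htotal u v huv
    grind
  · have := hasymm u v
    have := hasymm v u
    grind
  · have h1 := hcommon x y z
    unfold DirTriangle TriangleHasArc at *
    grind

/-- After reversing one arc of a transitive tournament, every directed triangle uses it. -/
lemma triangleHasArc_of_agree_off_arc {r : V → V → Prop} [IsStrictTotalOrder V r]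
    (hasymm : ∀ u v, A u v → ¬ A v u) {a b : V}
    (hr : ∀ u v, r u v → ¬ (u = a ∧ v = b) → A u v) {x y z : V} (h : DirTriangle A x y z) :
    TriangleHasArc b a x y z := by
  by_contra harc
  have hA : ∀ u v, u ≠ v → A u v → ¬ (u = b ∧ v = a) → r u v := by
    intro u v hne huv hba
    rcases trichotomous_of r u v with h1 | h1 | h1
    · exact h1
    · exact absurd h1 hne
    · exact absurd (hr v u h1 fun h => hba ⟨h.2, h.1⟩) (hasymm u v huv)
  obtain ⟨hxy, hyz, hzx, h1, h2, h3⟩ := h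
  unfold TriangleHasArc at harc
  push Not at harc
  have r1 := hA x y hxy h1 (fun h => harc.1 h.1 h.2)
  have r2 := hA y z hyz h2 (fun h => harc.2.1 h.1 h.2)
  have r3 := hA z x hzx h3 (fun h => harc.2.2 h.1 h.2)
  exact irrefl_of r x (_root_.trans (_root_.trans r1 r2) r3)

end Tournament

/-- An irreflexive tournament contains no two arc-disjoint directed triangles if and
only if it is obtained from a transitive tournament by reversing at most one arc. -/
theorem stmt_11 {V : Type*} [Fintype V] (A : V → V → Prop)
    (htour : ∀ u v : V, u ≠ v → (A u v ↔ ¬ A v u))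
    (hirr : ∀ v : V, ¬ A v v) :
    (¬ ∃ u v w x y z : V, DirTriangle A u v w ∧ DirTriangle A x y z ∧
        ({(u, v), (v, w), (w, u)} : Set (V × V)) ∩ {(x, y), (y, z), (z, x)} = ∅) ↔
      ReverseAtMostOneArc A := by
  have htotal : ∀ u v, u ≠ v → A u v ∨ A v u := fun u v h => by
    have := htour u v h
    tauto
  have hasymm : ∀ u v, A u v → ¬ A v u := fun u v h => by
    by_cases huv : u = v
    · exact absurd (huv ▸ h) (hirr v)
    · exact (htour u v huv).1 h
  constructor
  · intro hno
    have hshare : ∀ u v w x y z, DirTriangle A u v w → DirTriangle A x y z →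
        TriangleHasArc u v x y z ∨ TriangleHasArc v w x y z ∨ TriangleHasArc w u x y z :=
      fun u v w x y z h1 h2 => exists_triangleHasArc_of_inter_nonempty fun h =>
        hno ⟨u, v, w, x, y, z, h1, h2, h⟩
    by_cases hex : ∃ u v w, DirTriangle A u v w
    · obtain ⟨u, v, w, huvw⟩ := hex
      obtain ⟨a, b, c, habc, hcommon⟩ := exists_common_arc hasymm hshare huvw
      refine ⟨_, reverse_common_arc_isStrictTotalOrder htotal hasymm habc hcommon,
        Or.inr ⟨b, a, Or.inl ⟨rfl, rfl⟩, habc.2.2.2.1, fun u v h hne => ?_⟩⟩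
      exact (h.resolve_left hne).1
    · push Not at hex
      exact ⟨A, isStrictTotalOrder_of_no_dirTriangle htotal hasymm hex, Or.inl fun _ _ h => h⟩
  · rintro ⟨r, hr, h⟩ ⟨u, v, w, x, y, z, h1, h2, hdisj⟩
    obtain ⟨a, b, hab⟩ : ∃ a b, ∀ p q, r p q → ¬ (p = a ∧ q = b) → A p q := by
      rcases h with h | ⟨a, b, -, -, h⟩
      · exact ⟨u, u, fun p q hpq _ => h p q hpq⟩
      · exact ⟨a, b, h⟩
    have t1 := triangleHasArc_of_agree_off_arc hasymm hab h1
    have t2 := triangleHasArc_of_agree_off_arc hasymm hab h2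
    have hmem : (b, a) ∈ ({(u, v), (v, w), (w, u)} : Set (V × V)) ∩
        {(x, y), (y, z), (z, x)} := by
      unfold TriangleHasArc at t1 t2
      simp only [Set.mem_inter_iff, Set.mem_insert_iff, Set.mem_singleton_iff, Prod.mk.injEq]
      grind
    rw [hdisj] at hmem
    exact hmem
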